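/- Suppose F : ℂ₊ → ℂ is analytic, nonvanishing, ‖F‖_∞ ≤ 1, and F(s_i) = w_i for distinct points s₁, …, s_N ∈ ℂ₊ with w_i ≠ 0. Then there exist integers m₁, …, m_N such that the N×N matrix with (i,k)-entry ( -Log w_i - \overline{Log w_k} + 2πi(m_k - m_i) ) / (1 - φ(s_i)\overline{φ(s_k)}), where φ(s) = (s-1)/(s+1) and Log denotes the principal logarithm, is positive semidefinite. -/

import Mathlib

open Complex Set
open scoped ComplexOrder Real

open Metric in
lemma aux_pos {N : ℕ} (g : ℂ → ℂ) (hg : DiffContOnCl ℂ g (ball 0 1))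
    (hre : ∀ ζ ∈ sphere (0 : ℂ) 1, 0 ≤ (g ζ).re)
    (z : Fin N → ℂ) (hz : ∀ i, ‖z i‖ < 1) (c : Fin N → ℂ) :
    0 ≤ (∑ i, ∑ k, (starRingEnd ℂ) (c i) * (g (z i) / (1 - z i * (starRingEnd ℂ) (z k))) * c k).re := by
  have hne : ∀ k, ∀ ζ ∈ closedBall (0 : ℂ) 1, 1 - ζ * (starRingEnd ℂ) (z k) ≠ 0 := by
    intro k ζ hζ h
    have h1 : ζ * (starRingEnd ℂ) (z k) = 1 := (sub_eq_zero.mp h).symm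
    have h2 : ‖ζ‖ * ‖z k‖ = 1 := by
      simpa using congrArg norm h1
    have h3 : ‖ζ‖ ≤ 1 := by simpa using hζ
    nlinarith [hz k, norm_nonneg (z k), norm_nonneg ζ]
  set Q : ℂ → ℂ := fun ζ => ∑ k, c k / (1 - ζ * (starRingEnd ℂ) (z k)) with hQ
  have hQd : DiffContOnCl ℂ Q (ball 0 1) := by
    apply DifferentiableOn.diffContOnCl
    rw [closure_ball (0 : ℂ) one_ne_zero]
    refine DifferentiableOn.fun_sum fun k _ => ?_
    exact DifferentiableOn.div (by fun_prop) (by fun_prop) (hne k)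
  have hgQ : DiffContOnCl ℂ (fun ζ => g ζ * Q ζ) (ball 0 1) := by
    have := hg.smul hQd
    exact this
  have hcl : closure (ball (0 : ℂ) 1) = closedBall 0 1 := closure_ball (0 : ℂ) one_ne_zero
  have hcont : ContinuousOn (fun ζ => g ζ * Q ζ) (sphere (0 : ℂ) 1) := by
    have := hgQ.2
    rw [hcl] at this
    exact this.mono sphere_subset_closedBall
  have hnez : ∀ i, ∀ ζ ∈ sphere (0 : ℂ) 1, ζ - z i ≠ 0 := by
    intro i ζ hζ h
    have : ζ = z i := sub_eq_zero.mp h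
    have h3 : ‖ζ‖ = 1 := by simpa using hζ
    rw [this] at h3
    linarith [hz i]
  have hint : ∀ i, CircleIntegrable
      (fun ζ => (starRingEnd ℂ) (c i) * (((ζ - 0) / (ζ - z i)) * (g ζ * Q ζ))) 0 1 := by
    intro i
    apply ContinuousOn.circleIntegrable (by norm_num)
    refine ContinuousOn.mul continuousOn_const (ContinuousOn.mul ?_ hcont)
    exact ContinuousOn.div (by fun_prop) (by fun_prop) (hnez i)
  have hS : ∑ i, ∑ k, (starRingEnd ℂ) (c i) * (g (z i) / (1 - z i * (starRingEnd ℂ) (z k))) * c k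
      = Real.circleAverage (fun ζ => g ζ * ((‖Q ζ‖ ^ 2 : ℝ) : ℂ)) 0 1 := by
    have h1 : ∀ i, ∑ k, (starRingEnd ℂ) (c i) * (g (z i) / (1 - z i * (starRingEnd ℂ) (z k))) * c k
        = Real.circleAverage
          (fun ζ => (starRingEnd ℂ) (c i) * (((ζ - 0) / (ζ - z i)) * (g ζ * Q ζ))) 0 1 := by
      intro i
      have h2 := DiffContOnCl.circleAverage_smul_div (f := fun ζ => g ζ * Q ζ) (c := 0) (R := 1)
        (w := z i) (by simpa using hgQ) (by simpa using hz i)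
      have h3 := Real.circleAverage_fun_smul (a := (starRingEnd ℂ) (c i)) (c := 0) (R := 1)
        (f := fun ζ => ((ζ - 0) / (ζ - z i)) • (g ζ * Q ζ))
      rw [h2] at h3
      simp only [smul_eq_mul] at h3
      rw [h3, hQ, Finset.mul_sum, Finset.mul_sum]
      refine Finset.sum_congr rfl fun k _ => ?_
      ring
    rw [Finset.sum_congr rfl fun i _ => h1 i, ← Real.circleAverage_fun_sum fun i _ => hint i]
    apply Real.circleAverage_congr_sphere
    intro ζ hζ
    rw [abs_one] at hζ
    have hn : ζ * (starRingEnd ℂ) ζ = 1 := by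
      rw [Complex.mul_conj, Complex.normSq_eq_norm_sq]
      have h3 : ‖ζ‖ = 1 := by simpa using hζ
      simp [h3]
    have hconj : (starRingEnd ℂ) (Q ζ) = ∑ i, (starRingEnd ℂ) (c i) * (ζ / (ζ - z i)) := by
      simp only [hQ, map_sum, map_div₀, map_sub, map_one, map_mul, Complex.conj_conj]
      refine Finset.sum_congr rfl fun i _ => ?_
      have h4 := hnez i ζ hζ
      have h5 : ζ * (1 - (starRingEnd ℂ) ζ * z i) = ζ - z i := by
        linear_combination (-z i) * hn
      have h6 : 1 - (starRingEnd ℂ) ζ * z i ≠ 0 := by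
        intro h; rw [h, mul_zero] at h5; exact h4 h5.symm
      rw [← h5]
      have h7 : ζ ≠ 0 := by rintro rfl; simp at hn
      field_simp
    have hsq : ((‖Q ζ‖ ^ 2 : ℝ) : ℂ) = (starRingEnd ℂ) (Q ζ) * Q ζ := by
      rw [mul_comm, Complex.mul_conj, Complex.normSq_eq_norm_sq]
    change ∑ i, (starRingEnd ℂ) (c i) * (((ζ - 0) / (ζ - z i)) * (g ζ * Q ζ))
      = g ζ * ((‖Q ζ‖ ^ 2 : ℝ) : ℂ)
    rw [hsq, hconj]
    generalize Q ζ = q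
    rw [Finset.sum_mul, Finset.mul_sum]
    refine Finset.sum_congr rfl fun i _ => ?_
    rw [sub_zero]; ring
  rw [hS]
  have hci : CircleIntegrable (fun ζ => g ζ * ((‖Q ζ‖ ^ 2 : ℝ) : ℂ)) 0 1 := by
    apply ContinuousOn.circleIntegrable (by norm_num)
    have a := hg.2; have b := hQd.2
    rw [hcl] at a b
    refine ContinuousOn.mul (a.mono sphere_subset_closedBall) ?_
    exact Complex.continuous_ofReal.comp_continuousOn
      (((b.mono sphere_subset_closedBall).norm).pow 2)
  have hre2 : (Real.circleAverage (fun ζ => g ζ * ((‖Q ζ‖ ^ 2 : ℝ) : ℂ)) 0 1).re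
      = Real.circleAverage (fun ζ => (g ζ * ((‖Q ζ‖ ^ 2 : ℝ) : ℂ)).re) 0 1 := by
    rw [Real.circleAverage_def, Real.circleAverage_def]
    have := Complex.reCLM.intervalIntegral_comp_comm hci
    simp only [Complex.reCLM_apply] at this
    rw [this, Complex.smul_re]
  rw [hre2, Real.circleAverage_def]
  refine smul_nonneg (by positivity) (intervalIntegral.integral_nonneg (by positivity) ?_)
  intro θ _
  rw [Complex.re_mul_ofReal]
  exact mul_nonneg (hre _ (by simp)) (by positivity)

open Metric Filter Topology in
lemma aux_pos2 {N : ℕ} (g : ℂ → ℂ) (hg : DifferentiableOn ℂ g (ball 0 1))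
    (hre : ∀ ζ ∈ ball (0 : ℂ) 1, 0 ≤ (g ζ).re)
    (z : Fin N → ℂ) (hz : ∀ i, ‖z i‖ < 1) (c : Fin N → ℂ) :
    0 ≤ (∑ i, ∑ k, (starRingEnd ℂ) (c i) * (g (z i) / (1 - z i * (starRingEnd ℂ) (z k))) * c k).re := by
  have key : ∀ r ∈ Ioo (0 : ℝ) 1, 0 ≤ (∑ i, ∑ k, (starRingEnd ℂ) (c i) *
      (g (r * z i) / (1 - z i * (starRingEnd ℂ) (z k))) * c k).re := by
    intro r hr
    have hm : ∀ ζ ∈ closedBall (0 : ℂ) 1, (r : ℂ) * ζ ∈ ball (0 : ℂ) 1 := by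
      intro ζ hζ
      have h3 : ‖ζ‖ ≤ 1 := by simpa using hζ
      simp only [mem_ball, dist_zero_right, norm_mul, Complex.norm_real, Real.norm_eq_abs,
        abs_of_pos hr.1]
      nlinarith [hr.1, hr.2]
    refine aux_pos (fun ζ => g (r * ζ)) ?_ (fun ζ hζ => hre _ (hm _ (sphere_subset_closedBall hζ)))
      z hz c
    apply DifferentiableOn.diffContOnCl
    rw [closure_ball (0 : ℂ) one_ne_zero]
    exact hg.comp (by fun_prop) hm
  have ht : Tendsto (fun r : ℝ => (∑ i, ∑ k, (starRingEnd ℂ) (c i) *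
      (g (r * z i) / (1 - z i * (starRingEnd ℂ) (z k))) * c k).re) (𝓝[<] 1)
      (𝓝 (∑ i, ∑ k, (starRingEnd ℂ) (c i) *
        (g (z i) / (1 - z i * (starRingEnd ℂ) (z k))) * c k).re) := by
    refine (Complex.continuous_re.tendsto _).comp ?_
    refine tendsto_finsetSum _ fun i _ => tendsto_finsetSum _ fun k _ => ?_
    refine Tendsto.mul (Tendsto.mul tendsto_const_nhds (Tendsto.div_const ?_ _)) tendsto_const_nhds
    have hc : ContinuousAt g (z i) :=
      hg.continuousOn.continuousAt (isOpen_ball.mem_nhds (by simpa using hz i))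
    refine hc.tendsto.comp ?_
    have : Continuous (fun r : ℝ => (r : ℂ) * z i) := by fun_prop
    have h1 := this.tendsto 1
    simp only [Complex.ofReal_one, one_mul] at h1
    exact h1.mono_left nhdsWithin_le_nhds
  refine ge_of_tendsto ht ?_
  filter_upwards [Ioo_mem_nhdsLT (zero_lt_one : (0 : ℝ) < 1)] with r hr using key r hr

open Metric in
lemma aux_log (h : ℂ → ℂ) (hh : DifferentiableOn ℂ h (ball 0 1))
    (hne : ∀ ζ ∈ ball (0 : ℂ) 1, h ζ ≠ 0) :
    ∃ p : ℂ → ℂ, DifferentiableOn ℂ p (ball 0 1) ∧ ∀ ζ ∈ ball (0 : ℂ) 1, Complex.exp (p ζ) = h ζ := by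
  have hd : DifferentiableOn ℂ (fun ζ => deriv h ζ / h ζ) (ball 0 1) :=
    (hh.deriv isOpen_ball).div hh hne
  obtain ⟨p, hp0, hp⟩ := hd.isExactOn_ball.with_val_at 0 (Complex.log (h 0))
  refine ⟨p, fun ζ hζ => (hp ζ hζ).differentiableAt.differentiableWithinAt, ?_⟩
  have hder : ∀ ζ ∈ ball (0 : ℂ) 1, HasDerivAt (fun ζ => h ζ * Complex.exp (-p ζ)) 0 ζ := by
    intro ζ hζ
    have h1 := ((hh ζ hζ).differentiableAt (isOpen_ball.mem_nhds hζ)).hasDerivAt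
    have h2 := h1.mul (hp ζ hζ).neg.cexp
    have h3 := hne ζ hζ
    refine h2.congr_deriv ?_
    have h4 : h ζ * (deriv h ζ / h ζ) = deriv h ζ := by field_simp
    simp only [Pi.neg_apply]
    linear_combination (-Complex.exp (-p ζ)) * h4
  intro ζ hζ
  have h0 : (0 : ℂ) ∈ ball (0 : ℂ) 1 := by simp
  have hc := (convex_ball (0 : ℂ) 1).is_const_of_fderivWithin_eq_zero (𝕜 := ℂ)
    (f := fun ζ => h ζ * Complex.exp (-p ζ))
    (fun x hx => (hder x hx).differentiableAt.differentiableWithinAt)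
    (fun x hx => by
      rw [fderivWithin_of_isOpen isOpen_ball hx]
      ext
      simp [(hder x hx).deriv]) hζ h0
  simp only [hp0] at hc
  rw [Complex.exp_neg, Complex.exp_neg, Complex.exp_log (hne 0 h0), mul_inv_cancel₀ (hne 0 h0)] at hc
  field_simp [Complex.exp_ne_zero] at hc
  exact hc.symm

/-- If `F` is analytic, nonvanishing on ℂ₊ with `‖F‖_∞ ≤ 1` and `F (s i) = w i ≠ 0` at
distinct `s i ∈ ℂ₊`, then there are integers `m i` such that the matrix with entries
`(-Log (w i) - conj (Log (w k)) + 2πI (m k - m i)) / (1 - φ(s i) conj (φ(s k)))`,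
`φ(s) = (s-1)/(s+1)`, is positive semidefinite. -/
theorem stmt_5 (N : ℕ) (F : ℂ → ℂ)
    (hF : DifferentiableOn ℂ F {s : ℂ | 0 < s.re})
    (hFne : ∀ s ∈ {s : ℂ | 0 < s.re}, F s ≠ 0)
    (hFb : ∀ s ∈ {s : ℂ | 0 < s.re}, ‖F s‖ ≤ 1)
    (s : Fin N → ℂ) (hs : ∀ i, 0 < (s i).re) (hsdist : Function.Injective s)
    (w : Fin N → ℂ) (hw : ∀ i, F (s i) = w i) (hwne : ∀ i, w i ≠ 0) :
    ∃ m : Fin N → ℤ, Matrix.PosSemidef (Matrix.of fun i k : Fin N =>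
      (-(Complex.log (w i)) - (starRingEnd ℂ) (Complex.log (w k))
          + 2 * π * Complex.I * ((m k : ℂ) - (m i : ℂ))) /
        (1 - ((s i - 1) / (s i + 1)) * (starRingEnd ℂ) ((s k - 1) / (s k + 1)))) := by
  have hmap : ∀ ζ ∈ Metric.ball (0 : ℂ) 1, (1 + ζ) / (1 - ζ) ∈ {s : ℂ | 0 < s.re} ∧ 1 - ζ ≠ 0 := by
    intro ζ hζ
    have h1 : ‖ζ‖ < 1 := by simpa using hζ
    have hne : 1 - ζ ≠ 0 := by
      intro h
      rw [← sub_eq_zero.mp h] at h1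
      simp at h1
    refine ⟨?_, hne⟩
    have h2 : ζ.re * ζ.re + ζ.im * ζ.im < 1 := by
      rw [← Complex.normSq_apply, Complex.normSq_eq_norm_sq]
      nlinarith [norm_nonneg ζ]
    have h3 : 0 < Complex.normSq (1 - ζ) := Complex.normSq_pos.mpr hne
    show 0 < ((1 + ζ) / (1 - ζ)).re
    rw [Complex.div_re, ← add_div]
    apply div_pos _ h3
    simp
    nlinarith
  obtain ⟨p, hpd, hp⟩ := aux_log (fun ζ => F ((1 + ζ) / (1 - ζ)))
    (hF.comp (DifferentiableOn.div (by fun_prop) (by fun_prop) fun ζ hζ => (hmap ζ hζ).2)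
      fun ζ hζ => (hmap ζ hζ).1) (fun ζ hζ => hFne _ (hmap ζ hζ).1)
  have hpre : ∀ ζ ∈ Metric.ball (0 : ℂ) 1, 0 ≤ (-p ζ).re := by
    intro ζ hζ
    have h1 := hFb _ (hmap ζ hζ).1
    rw [← hp ζ hζ, Complex.norm_exp, Real.exp_le_one_iff] at h1
    simpa using h1
  set z : Fin N → ℂ := fun i => (s i - 1) / (s i + 1) with hzdef
  have hs1 : ∀ i, s i + 1 ≠ 0 := by
    intro i h
    have := congrArg Complex.re h
    simp at this
    linarith [hs i]
  have hz : ∀ i, ‖z i‖ < 1 := by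
    intro i
    rw [hzdef]
    simp only [norm_div]
    rw [div_lt_one (norm_pos_iff.mpr (hs1 i))]
    apply lt_of_pow_lt_pow_left₀ 2 (norm_nonneg _)
    rw [← Complex.normSq_eq_norm_sq, ← Complex.normSq_eq_norm_sq, Complex.normSq_apply,
      Complex.normSq_apply]
    simp
    nlinarith [hs i]
  have hzs : ∀ i, (1 + z i) / (1 - z i) = s i := by
    intro i
    have h1 := hs1 i
    have h2 : 1 + z i = 2 * s i / (s i + 1) := by
      simp only [hzdef]; field_simp; ring
    have h3 : 1 - z i = 2 / (s i + 1) := by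
      simp only [hzdef]; field_simp; ring
    rw [h2, h3]; field_simp
  have hm : ∀ i, ∃ n : ℤ, p (z i) = Complex.log (w i) + n * (2 * π * Complex.I) := by
    intro i
    rw [← Complex.exp_eq_exp_iff_exists_int, hp _ (by simpa using hz i), hzs, hw,
      Complex.exp_log (hwne i)]
  choose m hm using hm
  refine ⟨m, ?_⟩
  have hM : (Matrix.of fun i k : Fin N =>
      (-(Complex.log (w i)) - (starRingEnd ℂ) (Complex.log (w k))
          + 2 * π * Complex.I * ((m k : ℂ) - (m i : ℂ))) /
        (1 - z i * (starRingEnd ℂ) (z k)))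
      = Matrix.of fun i k : Fin N => (-p (z i) + (starRingEnd ℂ) (-p (z k))) /
        (1 - z i * (starRingEnd ℂ) (z k)) := by
    ext i k
    simp only [Matrix.of_apply, hm]
    congr 1
    have h2 : (starRingEnd ℂ) (2 : ℂ) = 2 := Complex.conj_ofNat 2
    simp [h2]
    ring
  show Matrix.PosSemidef (Matrix.of fun i k : Fin N =>
      (-(Complex.log (w i)) - (starRingEnd ℂ) (Complex.log (w k))
          + 2 * π * Complex.I * ((m k : ℂ) - (m i : ℂ))) /
        (1 - z i * (starRingEnd ℂ) (z k)))
  rw [hM]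
  refine Matrix.PosSemidef.of_dotProduct_mulVec_nonneg ?_ ?_
  · ext i k
    simp only [Matrix.conjTranspose_apply, Matrix.of_apply, RCLike.star_def]
    simp only [map_div₀, map_add, map_neg, map_sub, map_one, map_mul, Complex.conj_conj]
    congr 1 <;> ring
  · intro c
    have h1 := aux_pos2 (fun ζ => -p ζ) hpd.neg hpre z hz c
    set S := ∑ i, ∑ k, (starRingEnd ℂ) (c i) *
      ((fun ζ => -p ζ) (z i) / (1 - z i * (starRingEnd ℂ) (z k))) * c k with hS
    have h2 : star c ⬝ᵥ (Matrix.of fun i k : Fin N => (-p (z i) + (starRingEnd ℂ) (-p (z k))) /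
        (1 - z i * (starRingEnd ℂ) (z k))).mulVec c = S + (starRingEnd ℂ) S := by
      have h3 : (starRingEnd ℂ) S = ∑ i, ∑ k, (starRingEnd ℂ) (c i) *
          ((starRingEnd ℂ) (-p (z k)) / (1 - z i * (starRingEnd ℂ) (z k))) * c k := by
        rw [hS, Finset.sum_comm]
        simp only [map_sum]
        refine Finset.sum_congr rfl fun i _ => Finset.sum_congr rfl fun k _ => ?_
        simp only [map_div₀, map_neg, map_sub, map_one, map_mul, Complex.conj_conj]
        rw [mul_comm ((starRingEnd ℂ) (z k)) (z i)]
        ring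
      rw [h3, hS, ← Finset.sum_add_distrib]
      simp only [dotProduct, Matrix.mulVec, Finset.mul_sum]
      refine Finset.sum_congr rfl fun i _ => ?_
      rw [← Finset.sum_add_distrib]
      refine Finset.sum_congr rfl fun k _ => ?_
      simp only [Matrix.of_apply, Pi.star_apply, RCLike.star_def]
      ring
    rw [h2, Complex.add_conj]
    exact_mod_cast (by positivity : (0 : ℝ) ≤ 2 * S.re)
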